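/- Let W be a memoryless surjective channel with |𝒳| = |𝒴|. The maximizers of the optimization problem defining C*_f(Q) converge uniformly to the product distribution P_X^W ⊗ P_Y^W as δ → 0: for every ε > 0 there exists δ > 0 such that for every W-centered δ-approximately memoryless POST channel Q and every maximizer P* of the problem — maximize I(X;Y|Y′) over joint pmfs P on 𝒳 × 𝒴 subject to ∑_{x,y′} P(x,y′) Q(y|x,y′) = ∑_x P(x,y) for all y — one has max_{x,y} |P*(x,y) − P_X^W(x) P_Y^W(y)| ≤ ε. -/

import Mathlib

open scoped BigOperators

noncomputable section

/-- Conditional mutual information `I(A;B|C)` for a joint pmf `P` on finite types,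
with the conventions `0 · log 0 = 0` (and division by zero equal to zero)
and natural logarithm. -/
def condMI {A B C : Type*} [Fintype A] [Fintype B] [Fintype C]
    (P : A → B → C → ℝ) : ℝ :=
  ∑ a : A, ∑ b : B, ∑ c : C,
    P a b c *
      Real.log ((P a b c * ∑ a' : A, ∑ b' : B, P a' b' c) /
        ((∑ b' : B, P a b' c) * (∑ a' : A, P a' b c)))

/-- `Q x y' y` represents the POST-channel transition kernel `Q(y | x, y')`. -/
def IsPOST {X Y : Type*} [Fintype X] [Fintype Y] (Q : X → Y → Y → ℝ) : Prop :=
  (∀ x y' y, 0 ≤ Q x y' y) ∧ ∀ x y', ∑ y : Y, Q x y' y = 1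

/-- A joint pmf `P(x, y')` on `X × Y`. -/
def IsJointPmf {X Y : Type*} [Fintype X] [Fintype Y] (P : X → Y → ℝ) : Prop :=
  (∀ x y, 0 ≤ P x y) ∧ ∑ x : X, ∑ y : Y, P x y = 1

/-- The stationarity constraint `∑_{x,y'} P(x,y') Q(y|x,y') = ∑_x P(x,y)` for all `y`. -/
def StationaryFor {X Y : Type*} [Fintype X] [Fintype Y]
    (Q : X → Y → Y → ℝ) (P : X → Y → ℝ) : Prop :=
  ∀ y : Y, ∑ x : X, ∑ y' : Y, P x y' * Q x y' y = ∑ x : X, P x y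

/-- `I(X;Y|Y')` computed under the joint law `P(x,y') Q(y|x,y')`. -/
def fbMI {X Y : Type*} [Fintype X] [Fintype Y]
    (Q : X → Y → Y → ℝ) (P : X → Y → ℝ) : ℝ :=
  condMI (fun (x : X) (y : Y) (y' : Y) => P x y' * Q x y' y)

/-- `P` is a maximizer of the optimization problem defining `C*_f(Q)`. -/
def IsFbMaximizer {X Y : Type*} [Fintype X] [Fintype Y]
    (Q : X → Y → Y → ℝ) (P : X → Y → ℝ) : Prop :=
  IsJointPmf P ∧ StationaryFor Q P ∧
    ∀ P' : X → Y → ℝ, IsJointPmf P' → StationaryFor Q P' → fbMI Q P' ≤ fbMI Q P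

/-- The feedback capacity functional `C*_f(Q)`. -/
def Cfstar {X Y : Type*} [Fintype X] [Fintype Y] (Q : X → Y → Y → ℝ) : ℝ :=
  sSup {r : ℝ | ∃ P : X → Y → ℝ, IsJointPmf P ∧ StationaryFor Q P ∧ fbMI Q P = r}

/-- The state preceding time `t` in a length-`n` block with initial state `y0`. -/
def prevState {Y : Type*} (n : ℕ) (y0 : Y) (ys : Fin n → Y) (t : Fin n) : Y :=
  if (t : ℕ) = 0 then y0
  else ys ⟨(t : ℕ) - 1, lt_of_le_of_lt (Nat.sub_le _ _) t.isLt⟩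

/-- A joint pmf `P(x^n, y_0)` on `𝒳^n × 𝒴`. -/
def IsJointPmfN {X Y : Type*} [Fintype X] [Fintype Y] (n : ℕ)
    (P : (Fin n → X) → Y → ℝ) : Prop :=
  (∀ xs y0, 0 ≤ P xs y0) ∧ ∑ xs : Fin n → X, ∑ y0 : Y, P xs y0 = 1

/-- The induced joint law `P(x^n,y_0) ∏_{t=1}^n Q(y_t|x_t,y_{t-1})`. -/
def nLaw {X Y : Type*} [Fintype X] [Fintype Y]
    (Q : X → Y → Y → ℝ) (n : ℕ) (P : (Fin n → X) → Y → ℝ) :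
    (Fin n → X) → (Fin n → Y) → Y → ℝ :=
  fun xs ys y0 => P xs y0 * ∏ t : Fin n, Q (xs t) (prevState n y0 ys t) (ys t)

/-- `C_n(Q) = (1/n) max_{P_{X^n Y_0}} I(X^n; Y^n | Y_0)`. -/
def Cn {X Y : Type*} [Fintype X] [Fintype Y] (Q : X → Y → Y → ℝ) (n : ℕ) : ℝ :=
  sSup {r : ℝ | ∃ P : (Fin n → X) → Y → ℝ, IsJointPmfN n P ∧
    r = (1 / (n : ℝ)) * condMI (nLaw Q n P)}

/-- A pmf on a finite set. -/
def IsPmf {X : Type*} [Fintype X] (p : X → ℝ) : Prop :=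
  (∀ x, 0 ≤ p x) ∧ ∑ x : X, p x = 1

/-- The mutual information `I(X;Y)` across the memoryless channel `W` with input pmf `p`. -/
def mlMI {X Y : Type*} [Fintype X] [Fintype Y] (W : X → Y → ℝ) (p : X → ℝ) : ℝ :=
  ∑ x : X, ∑ y : Y, p x * W x y * Real.log (W x y / ∑ x' : X, p x' * W x' y)

/-- The conditional output kernel `P_{Y|Y'}(y|y') = ∑_x P_{X|Y'}(x|y') Q(y|x,y')`. -/
def condOut {X Y : Type*} [Fintype X] [Fintype Y]
    (Q : X → Y → Y → ℝ) (P : X → Y → ℝ) (y' y : Y) : ℝ :=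
  (∑ x : X, P x y' * Q x y' y) / (∑ x : X, P x y')

open Filter Topology

/-- Entropy form of the objective. -/
def entF {α : Type*} [Fintype α] (Q : α → α → α → ℝ) (P : α → α → ℝ) : ℝ :=
  ∑ y' : α, ∑ y : α, Real.negMulLog (∑ x : α, P x y' * Q x y' y)
    - ∑ y' : α, Real.negMulLog (∑ x : α, P x y')
    - ∑ x : α, ∑ y' : α, ∑ y : α, P x y' * Real.negMulLog (Q x y' y)

theorem entF_tendsto {α : Type*} [Fintype α] {Q : ℕ → α → α → α → ℝ} {P : ℕ → α → α → ℝ}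
    {Q0 : α → α → α → ℝ} {P0 : α → α → ℝ} (hQ : Tendsto Q atTop (𝓝 Q0))
    (hP : Tendsto P atTop (𝓝 P0)) :
    Tendsto (fun n => entF (Q n) (P n)) atTop (𝓝 (entF Q0 P0)) := by
  have hPe : ∀ a b, Tendsto (fun n => P n a b) atTop (𝓝 (P0 a b)) := fun a b =>
    (tendsto_pi_nhds.mp ((tendsto_pi_nhds.mp hP) a)) b
  have hQe : ∀ a b c, Tendsto (fun n => Q n a b c) atTop (𝓝 (Q0 a b c)) := fun a b c =>
    (tendsto_pi_nhds.mp ((tendsto_pi_nhds.mp ((tendsto_pi_nhds.mp hQ) a)) b)) c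
  have hη : ∀ {u : ℕ → ℝ} {l : ℝ}, Tendsto u atTop (𝓝 l) →
      Tendsto (fun n => Real.negMulLog (u n)) atTop (𝓝 (Real.negMulLog l)) := fun {u l} h =>
    (Real.continuous_negMulLog.tendsto l).comp h
  unfold entF
  refine Tendsto.sub (Tendsto.sub ?_ ?_) ?_
  · exact tendsto_finsetSum _ fun b _ => tendsto_finsetSum _ fun c _ =>
      hη (tendsto_finsetSum _ fun a _ => (hPe a b).mul (hQe a b c))
  · exact tendsto_finsetSum _ fun b _ => hη (tendsto_finsetSum _ fun a _ => hPe a b)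
  · exact tendsto_finsetSum _ fun a _ => tendsto_finsetSum _ fun b _ =>
      tendsto_finsetSum _ fun c _ => (hPe a b).mul (hη (hQe a b c))

theorem fbMI_eq {α : Type*} [Fintype α] (Q : α → α → α → ℝ) (P : α → α → ℝ)
    (hQ : IsPOST Q) (hP : ∀ x y, 0 ≤ P x y) : fbMI Q P = entF Q P := by
  obtain ⟨hQ0, hQ1⟩ := hQ
  unfold fbMI condMI
  have hmarg : ∀ y', ∑ x : α, ∑ b : α, P x y' * Q x y' b = ∑ x : α, P x y' := by
    intro y'
    refine Finset.sum_congr rfl fun x _ => ?_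
    rw [← Finset.mul_sum, hQ1, mul_one]
  have key : ∀ x y y', P x y' * Q x y' y *
      Real.log ((P x y' * Q x y' y * ∑ a' : α, ∑ b' : α, P a' y' * Q a' y' b') /
        ((∑ b' : α, P x y' * Q x y' b') * (∑ a' : α, P a' y' * Q a' y' y)))
      = P x y' * Q x y' y * Real.log (Q x y' y)
        + P x y' * Q x y' y * Real.log (∑ x : α, P x y')
        - P x y' * Q x y' y * Real.log (∑ x : α, P x y' * Q x y' y) := by
    intro x y y'
    rw [hmarg, ← Finset.mul_sum, hQ1, mul_one]
    by_cases h : P x y' * Q x y' y = 0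
    · rw [h]; ring
    have hp : P x y' ≠ 0 := left_ne_zero_of_mul h
    have hq : Q x y' y ≠ 0 := right_ne_zero_of_mul h
    have h1 : 0 < ∑ x : α, P x y' :=
      Finset.sum_pos' (fun i _ => hP i y') ⟨x, Finset.mem_univ _, lt_of_le_of_ne (hP x y') hp.symm⟩
    have h2 : 0 < ∑ x : α, P x y' * Q x y' y :=
      Finset.sum_pos' (fun i _ => mul_nonneg (hP i y') (hQ0 _ _ _))
        ⟨x, Finset.mem_univ _, lt_of_le_of_ne (mul_nonneg (hP x y') (hQ0 _ _ _)) (Ne.symm h)⟩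
    rw [Real.log_div (mul_ne_zero h h1.ne') (mul_ne_zero hp h2.ne'),
      Real.log_mul h h1.ne', Real.log_mul hp hq, Real.log_mul hp h2.ne']
    ring
  simp only [key, Finset.sum_add_distrib, Finset.sum_sub_distrib]
  have e1 : ∑ x : α, ∑ y : α, ∑ y' : α, P x y' * Q x y' y * Real.log (Q x y' y)
      = - ∑ x : α, ∑ y' : α, ∑ y : α, P x y' * Real.negMulLog (Q x y' y) := by
    rw [← Finset.sum_neg_distrib]
    refine Finset.sum_congr rfl fun x _ => ?_
    rw [Finset.sum_comm, ← Finset.sum_neg_distrib]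
    refine Finset.sum_congr rfl fun y _ => ?_
    rw [← Finset.sum_neg_distrib]
    refine Finset.sum_congr rfl fun y' _ => ?_
    unfold Real.negMulLog; ring
  have e2 : ∑ x : α, ∑ y : α, ∑ y' : α, P x y' * Q x y' y * Real.log (∑ x : α, P x y')
      = - ∑ y' : α, Real.negMulLog (∑ x : α, P x y') := by
    have : ∀ x, ∑ y : α, ∑ y' : α, P x y' * Q x y' y * Real.log (∑ x : α, P x y')
        = ∑ y' : α, P x y' * Real.log (∑ x : α, P x y') := by
      intro x
      rw [Finset.sum_comm]
      refine Finset.sum_congr rfl fun y' _ => ?_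
      rw [← Finset.sum_mul, ← Finset.mul_sum, hQ1, mul_one]
    simp only [this]
    rw [Finset.sum_comm, ← Finset.sum_neg_distrib]
    refine Finset.sum_congr rfl fun y' _ => ?_
    rw [← Finset.sum_mul]; unfold Real.negMulLog; ring
  have e3 : ∑ x : α, ∑ y : α, ∑ y' : α,
      P x y' * Q x y' y * Real.log (∑ x : α, P x y' * Q x y' y)
      = - ∑ y' : α, ∑ y : α, Real.negMulLog (∑ x : α, P x y' * Q x y' y) := by
    rw [Finset.sum_comm]
    have : ∀ y, ∑ x : α, ∑ y' : α, P x y' * Q x y' y * Real.log (∑ x : α, P x y' * Q x y' y)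
        = ∑ y' : α, - Real.negMulLog (∑ x : α, P x y' * Q x y' y) := by
      intro y
      rw [Finset.sum_comm]
      refine Finset.sum_congr rfl fun y' _ => ?_
      rw [← Finset.sum_mul]; unfold Real.negMulLog; ring
    simp only [this]
    rw [Finset.sum_comm]
    simp only [Finset.sum_neg_distrib]
  rw [e1, e2, e3]
  unfold entF
  ring

theorem mlMI_eq {α : Type*} [Fintype α] (W : α → α → ℝ) (p : α → ℝ)
    (hW0 : ∀ x y, 0 ≤ W x y) (hp : ∀ x, 0 ≤ p x) :
    mlMI W p = ∑ y : α, Real.negMulLog (∑ x : α, p x * W x y)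
      - ∑ x : α, ∑ y : α, p x * Real.negMulLog (W x y) := by
  unfold mlMI
  have key : ∀ x y, p x * W x y * Real.log (W x y / ∑ x' : α, p x' * W x' y)
      = p x * W x y * - Real.log (∑ x' : α, p x' * W x' y) - p x * Real.negMulLog (W x y) := by
    intro x y
    by_cases h : p x * W x y = 0
    · have : p x * Real.negMulLog (W x y) = - (p x * W x y) * Real.log (W x y) := by
        unfold Real.negMulLog; ring
      rw [this, h]; ring
    have hq : W x y ≠ 0 := right_ne_zero_of_mul h
    have h2 : 0 < ∑ x : α, p x * W x y :=
      Finset.sum_pos' (fun i _ => mul_nonneg (hp i) (hW0 _ _))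
        ⟨x, Finset.mem_univ _, lt_of_le_of_ne (mul_nonneg (hp x) (hW0 _ _)) (Ne.symm h)⟩
    rw [Real.log_div hq h2.ne']
    unfold Real.negMulLog; ring
  simp only [key, Finset.sum_sub_distrib]
  congr 1
  rw [Finset.sum_comm]
  refine Finset.sum_congr rfl fun y _ => ?_
  rw [← Finset.sum_mul]; unfold Real.negMulLog; ring

theorem entF_prod {α : Type*} [Fintype α] (W : α → α → ℝ)
    (hW0 : ∀ x y, 0 ≤ W x y) (hW1 : ∀ x, ∑ y : α, W x y = 1) (p : α → ℝ) (hp : IsPmf p) :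
    entF (fun x _ y => W x y) (fun x y => p x * ∑ x' : α, p x' * W x' y) = mlMI W p := by
  rw [mlMI_eq W p hW0 hp.1]
  set r : α → ℝ := fun y => ∑ x' : α, p x' * W x' y with hr
  have hr1 : ∑ y, r y = 1 := by
    simp only [hr]
    rw [Finset.sum_comm]
    simp only [← Finset.mul_sum, hW1, mul_one]
    exact hp.2
  change entF (fun x _ y => W x y) (fun x y => p x * r y) = ∑ y, Real.negMulLog (r y) - _
  unfold entF
  have a1 : ∀ y' y, ∑ x : α, p x * r y' * W x y = r y' * r y := by
    intro y' y
    simp only [hr]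
    rw [Finset.mul_sum]
    exact Finset.sum_congr rfl fun x _ => by ring
  have a2 : ∀ y', ∑ x : α, p x * r y' = r y' := by
    intro y'; rw [← Finset.sum_mul, hp.2, one_mul]
  have a3 : ∀ x, ∑ y' : α, ∑ y : α, p x * r y' * Real.negMulLog (W x y)
      = ∑ y : α, p x * Real.negMulLog (W x y) := by
    intro x
    simp only [← Finset.mul_sum]
    rw [← Finset.sum_mul, ← Finset.mul_sum, hr1, mul_one]
  simp only [a3]
  simp only [a1, a2, Real.negMulLog_mul, Finset.sum_add_distrib, ← Finset.mul_sum,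
    ← Finset.sum_mul, hr1]
  ring

/-- Gibbs inequality, pointwise. -/
theorem gibbs_pt (a b : ℝ) (ha : 0 ≤ a) (hb : 0 < b) :
    Real.negMulLog a ≤ - a * Real.log b + b - a ∧
      (Real.negMulLog a = - a * Real.log b + b - a → a = b) := by
  rcases ha.eq_or_lt with h | h
  · subst h
    simp
    exact hb.le
  have e : Real.negMulLog a = - a * Real.log b + a * Real.log (b / a) := by
    rw [Real.log_div hb.ne' h.ne']; unfold Real.negMulLog; ring
  have e2 : a * (b / a - 1) = b - a := by field_simp
  constructor
  · have := Real.log_le_sub_one_of_pos (div_pos hb h)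
    nlinarith
  · intro heq
    by_contra hne
    have : b / a ≠ 1 := by
      intro h1; rw [div_eq_one_iff_eq h.ne'] at h1; exact hne h1.symm
    have := Real.log_lt_sub_one_of_pos (div_pos hb h) this
    nlinarith

/-- Conditioning reduces entropy, with equality case. -/
theorem gibbs_ind {α : Type*} [Fintype α] (a : α → α → ℝ) (q : α → ℝ)
    (ha : ∀ i j, 0 ≤ a i j) (h1 : ∀ i, ∑ j, a i j = q i) (h2 : ∀ j, ∑ i, a i j = q j)
    (hq : ∑ i, q i = 1) :
    ∑ i, ∑ j, Real.negMulLog (a i j) ≤ 2 * ∑ i, Real.negMulLog (q i) ∧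
    (2 * ∑ i, Real.negMulLog (q i) ≤ ∑ i, ∑ j, Real.negMulLog (a i j) →
      ∀ i j, a i j = q i * q j) := by
  have hq0 : ∀ i, 0 ≤ q i := fun i => by rw [← h1]; exact Finset.sum_nonneg fun j _ => ha i j
  have z1 : ∀ i j, q i = 0 → a i j = 0 := by
    intro i j h
    rw [← h1, Finset.sum_eq_zero_iff_of_nonneg (fun j _ => ha i j)] at h
    exact h j (Finset.mem_univ _)
  have z2 : ∀ i j, q j = 0 → a i j = 0 := by
    intro i j h
    rw [← h2, Finset.sum_eq_zero_iff_of_nonneg (fun i _ => ha i j)] at h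
    exact h i (Finset.mem_univ _)
  have pt : ∀ i j, Real.negMulLog (a i j) ≤
      a i j * - Real.log (q i) + a i j * - Real.log (q j) + q i * q j - a i j ∧
      (Real.negMulLog (a i j) =
      a i j * - Real.log (q i) + a i j * - Real.log (q j) + q i * q j - a i j →
        a i j = q i * q j) := by
    intro i j
    by_cases hi : q i = 0
    · rw [z1 i j hi, hi]; simp
    by_cases hj : q j = 0
    · rw [z2 i j hj, hj]; simp
    have := gibbs_pt (a i j) (q i * q j) (ha i j)
      (mul_pos (lt_of_le_of_ne (hq0 i) (Ne.symm hi)) (lt_of_le_of_ne (hq0 j) (Ne.symm hj)))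
    rw [Real.log_mul hi hj] at this
    have e : - a i j * (Real.log (q i) + Real.log (q j)) + q i * q j - a i j
      = a i j * - Real.log (q i) + a i j * - Real.log (q j) + q i * q j - a i j := by ring
    rwa [e] at this
  have tot : ∑ i, ∑ j,
      (a i j * - Real.log (q i) + a i j * - Real.log (q j) + q i * q j - a i j)
      = 2 * ∑ i, Real.negMulLog (q i) := by
    simp only [Finset.sum_add_distrib, Finset.sum_sub_distrib]
    have b1 : ∑ i, ∑ j, a i j * - Real.log (q i) = ∑ i, Real.negMulLog (q i) := by
      refine Finset.sum_congr rfl fun i _ => ?_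
      rw [← Finset.sum_mul, h1]; unfold Real.negMulLog; ring
    have b2 : ∑ i, ∑ j, a i j * - Real.log (q j) = ∑ i, Real.negMulLog (q i) := by
      rw [Finset.sum_comm]
      refine Finset.sum_congr rfl fun i _ => ?_
      rw [← Finset.sum_mul, h2]; unfold Real.negMulLog; ring
    have b3 : ∑ i, ∑ j, q i * q j = 1 := by
      simp only [← Finset.mul_sum, hq, mul_one]
    have b4 : ∑ i, ∑ j, a i j = 1 := by simp only [h1, hq]
    rw [b1, b2, b3, b4]; ring
  refine ⟨?_, fun h i j => ?_⟩
  · rw [← tot]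
    exact Finset.sum_le_sum fun i _ => Finset.sum_le_sum fun j _ => (pt i j).1
  · by_contra hne
    have hlt := lt_of_le_of_ne (pt i j).1 (fun h => hne ((pt i j).2 h))
    rw [← tot] at h
    refine absurd h (not_le.mpr ?_)
    refine Finset.sum_lt_sum (fun i _ => Finset.sum_le_sum fun j _ => (pt i j).1)
      ⟨i, Finset.mem_univ _, ?_⟩
    exact Finset.sum_lt_sum (fun j _ => (pt i j).1) ⟨j, Finset.mem_univ _, hlt⟩

theorem inj_of_inv {α : Type*} [Fintype α] [DecidableEq α] (W : α → α → ℝ)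
    (hinv : IsUnit ((Matrix.of fun y x => W x y) : Matrix α α ℝ)) (u v : α → ℝ)
    (h : ∀ y, ∑ x, u x * W x y = ∑ x, v x * W x y) : u = v := by
  apply Matrix.mulVec_injective_of_isUnit hinv
  funext y
  simp only [Matrix.mulVec, dotProduct, Matrix.of_apply]
  simpa only [mul_comm] using h y

/-- Uniqueness of the capacity-achieving input. -/
theorem opt_unique {α : Type*} [Fintype α] [DecidableEq α] (W : α → α → ℝ)
    (hW0 : ∀ x y, 0 ≤ W x y)
    (hinv : IsUnit ((Matrix.of fun y x => W x y) : Matrix α α ℝ))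
    (pX : α → ℝ) (hpX : IsPmf pX)
    (hpXopt : ∀ p : α → ℝ, IsPmf p → mlMI W p ≤ mlMI W pX)
    (p : α → ℝ) (hp : IsPmf p) (hge : mlMI W pX ≤ mlMI W p) : p = pX := by
  apply inj_of_inv W hinv
  by_contra! hne
  obtain ⟨y, hy⟩ := hne
  set m : α → ℝ := fun x => (1/2) * p x + (1/2) * pX x with hm
  have hmp : IsPmf m := by
    refine ⟨fun x => ?_, ?_⟩
    · have := hp.1 x; have := hpX.1 x; simp only [hm]; positivity
    · simp only [hm, Finset.sum_add_distrib, ← Finset.mul_sum, hp.2, hpX.2]; norm_num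
  have hopt := hpXopt m hmp
  rw [mlMI_eq W _ hW0 hmp.1, mlMI_eq W _ hW0 hpX.1] at hopt
  rw [mlMI_eq W _ hW0 hp.1, mlMI_eq W _ hW0 hpX.1] at hge
  have l1 : ∑ x, ∑ y, m x * Real.negMulLog (W x y)
      = (1/2) * ∑ x, ∑ y, p x * Real.negMulLog (W x y)
        + (1/2) * ∑ x, ∑ y, pX x * Real.negMulLog (W x y) := by
    simp only [Finset.mul_sum, ← Finset.sum_add_distrib, hm]
    exact Finset.sum_congr rfl fun x _ => Finset.sum_congr rfl fun y _ => by ring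
  have l2 : ∀ y, ∑ x, m x * W x y = (1/2) * ∑ x, p x * W x y + (1/2) * ∑ x, pX x * W x y := by
    intro y
    simp only [Finset.mul_sum, ← Finset.sum_add_distrib, hm]
    exact Finset.sum_congr rfl fun x _ => by ring
  have n1 : ∀ y, 0 ≤ ∑ x, p x * W x y :=
    fun y => Finset.sum_nonneg fun x _ => mul_nonneg (hp.1 x) (hW0 _ _)
  have n2 : ∀ y, 0 ≤ ∑ x, pX x * W x y :=
    fun y => Finset.sum_nonneg fun x _ => mul_nonneg (hpX.1 x) (hW0 _ _)
  have c : ∑ y, ((1/2) * Real.negMulLog (∑ x, p x * W x y)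
        + (1/2) * Real.negMulLog (∑ x, pX x * W x y))
      < ∑ y, Real.negMulLog (∑ x, m x * W x y) := by
    refine Finset.sum_lt_sum (fun y _ => ?_) ⟨y, Finset.mem_univ _, ?_⟩
    · rw [l2]
      exact Real.concaveOn_negMulLog.2 (n1 y) (n2 y) (by norm_num) (by norm_num) (by norm_num)
    · rw [l2]
      exact Real.strictConcaveOn_negMulLog.2 (n1 y) (n2 y) hy
        (by norm_num) (by norm_num) (by norm_num)
  rw [Finset.sum_add_distrib, ← Finset.mul_sum, ← Finset.mul_sum] at c
  rw [l1] at hopt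
  linarith

/-- Uniqueness of the maximizer for the memoryless channel. -/
theorem limit_unique {α : Type*} [Fintype α] [DecidableEq α] (W : α → α → ℝ)
    (hW0 : ∀ x y, 0 ≤ W x y) (hW1 : ∀ x, ∑ y : α, W x y = 1)
    (hinv : IsUnit ((Matrix.of fun y x => W x y) : Matrix α α ℝ))
    (pX : α → ℝ) (hpX : IsPmf pX)
    (hpXopt : ∀ p : α → ℝ, IsPmf p → mlMI W p ≤ mlMI W pX)
    (P : α → α → ℝ) (hP : IsJointPmf P) (hS : StationaryFor (fun x _ y => W x y) P)
    (hge : mlMI W pX ≤ entF (fun x _ y => W x y) P) :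
    ∀ x y, P x y = pX x * ∑ x' : α, pX x' * W x' y := by
  set p : α → ℝ := fun x => ∑ y, P x y with hpdef
  set q : α → ℝ := fun y => ∑ x, P x y with hqdef
  have hp : IsPmf p := ⟨fun x => Finset.sum_nonneg fun y _ => hP.1 x y, hP.2⟩
  have hq : ∑ y, q y = 1 := by simp only [hqdef]; rw [Finset.sum_comm]; exact hP.2
  have hpq : ∀ y, ∑ x, p x * W x y = q y := by
    intro y
    have := hS y
    simp only [← Finset.sum_mul] at this
    exact this
  have G := gibbs_ind (fun y' y => ∑ x, P x y' * W x y) q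
    (fun i j => Finset.sum_nonneg fun x _ => mul_nonneg (hP.1 _ _) (hW0 _ _))
    (by
      intro i
      rw [Finset.sum_comm]
      simp only [← Finset.mul_sum, hW1, mul_one, hqdef])
    (by
      intro j
      rw [Finset.sum_comm, ← hpq]
      simp only [← Finset.sum_mul, hpdef])
    hq
  have hF : entF (fun x _ y => W x y) P
      = ∑ i, ∑ j, Real.negMulLog (∑ x, P x i * W x j) - ∑ i, Real.negMulLog (q i)
        - ∑ x, ∑ y, p x * Real.negMulLog (W x y) := by
    unfold entF
    congr 1
    refine Finset.sum_congr rfl fun x _ => ?_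
    rw [Finset.sum_comm]
    simp only [← Finset.sum_mul, hpdef]
  have hm := mlMI_eq W p hW0 hp.1
  simp only [hpq] at hm
  have hopt := hpXopt p hp
  have hpeq : p = pX := by
    apply opt_unique W hW0 hinv pX hpX hpXopt p hp
    have := G.1
    linarith
  have hind := G.2 (by linarith)
  intro x y
  rw [← hpeq, hpq]
  have := inj_of_inv W hinv (fun x => P x y) (fun x => p x * q y) (by
    intro z
    have h := hind y z
    rw [h, ← hpq z, Finset.mul_sum]
    exact Finset.sum_congr rfl fun x _ => by ring)
  exact congrFun this x

/-- Near `W` there are feasible points converging to the product distribution. -/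
theorem feasible_seq {α : Type*} [Fintype α] [DecidableEq α] (W : α → α → ℝ)
    (hW0 : ∀ x y, 0 ≤ W x y) (hW1 : ∀ x, ∑ y : α, W x y = 1)
    (hinv : IsUnit ((Matrix.of fun y x => W x y) : Matrix α α ℝ))
    (pX : α → ℝ) (hpX : IsPmf pX) (hpos : ∀ x, 0 < pX x)
    (Q : ℕ → α → α → α → ℝ) (hQ : ∀ n, IsPOST (Q n))
    (hlim : Tendsto Q atTop (𝓝 (fun x _ y => W x y))) :
    ∃ R : ℕ → α → α → ℝ,
      Tendsto R atTop (𝓝 (fun x y => pX x * ∑ x' : α, pX x' * W x' y)) ∧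
      ∀ᶠ n in atTop, IsJointPmf (R n) ∧ StationaryFor (Q n) (R n) := by
  set r : α → ℝ := fun y => ∑ x' : α, pX x' * W x' y with hr
  have hr0 : ∀ y, 0 ≤ r y := fun y => Finset.sum_nonneg fun x _ => mul_nonneg (hpX.1 x) (hW0 _ _)
  have hr1 : ∑ y, r y = 1 := by
    simp only [hr]
    rw [Finset.sum_comm]
    simp only [← Finset.mul_sum, hW1, mul_one]
    exact hpX.2
  set A : Matrix α α ℝ := Matrix.of fun y x => W x y with hA
  have hdet : A.det ≠ 0 := by
    rw [Matrix.isUnit_iff_isUnit_det] at hinv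
    exact hinv.ne_zero
  let B : ℕ → α → Matrix α α ℝ := fun n y' => Matrix.of fun y x => Q n x y' y
  have hQe : ∀ x y' y, Tendsto (fun n => Q n x y' y) atTop (𝓝 (W x y)) := by
    intro x y' y
    have h1 := (tendsto_pi_nhds.mp hlim) x
    have h2 := (tendsto_pi_nhds.mp h1) y'
    exact (tendsto_pi_nhds.mp h2) y
  have hB : ∀ y', Tendsto (fun n => B n y') atTop (𝓝 A) := by
    intro y'
    refine tendsto_pi_nhds.mpr fun y => tendsto_pi_nhds.mpr fun x => ?_
    exact hQe x y' y
  have hBdet : ∀ y', Tendsto (fun n => (B n y').det) atTop (𝓝 A.det) := fun y' =>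
    ((continuous_id.matrix_det).tendsto A).comp (hB y')
  have hBinv : ∀ y', Tendsto (fun n => (B n y')⁻¹) atTop (𝓝 A⁻¹) := by
    intro y'
    simp only [Matrix.inv_def, Ring.inverse_eq_inv']
    exact ((hBdet y').inv₀ hdet).smul (((continuous_id.matrix_adjugate).tendsto A).comp (hB y'))
  have hpXeq : A⁻¹.mulVec r = pX := by
    have : r = A.mulVec pX := by
      funext y
      simp only [hr, hA, Matrix.mulVec, dotProduct, Matrix.of_apply]
      exact Finset.sum_congr rfl fun x _ => by ring
    rw [this, Matrix.mulVec_mulVec, Matrix.nonsing_inv_mul _ (isUnit_iff_ne_zero.mpr hdet),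
      Matrix.one_mulVec]
  let c : ℕ → α → α → ℝ := fun n y' => ((B n y')⁻¹).mulVec r
  have hc : ∀ y', Tendsto (fun n => c n y') atTop (𝓝 pX) := by
    intro y'
    rw [← hpXeq]
    have hcont : Continuous (fun M : Matrix α α ℝ => M.mulVec r) :=
      continuous_id.matrix_mulVec continuous_const
    exact (hcont.tendsto _).comp (hBinv y')
  have hce : ∀ y' x, Tendsto (fun n => c n y' x) atTop (𝓝 (pX x)) := fun y' x =>
    (tendsto_pi_nhds.mp (hc y')) x
  refine ⟨fun n x y' => c n y' x * r y', ?_, ?_⟩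
  · refine tendsto_pi_nhds.mpr fun x => tendsto_pi_nhds.mpr fun y => ?_
    exact (hce y x).mul_const _
  · have ev1 : ∀ᶠ n in atTop, ∀ y' x, 0 < c n y' x := by
      rw [eventually_all]; intro y'
      rw [eventually_all]; intro x
      exact (hce y' x).eventually (lt_mem_nhds (hpos x))
    have ev2 : ∀ᶠ n in atTop, ∀ y', (B n y').det ≠ 0 := by
      rw [eventually_all]; intro y'
      exact (hBdet y').eventually_ne hdet
    filter_upwards [ev1, ev2] with n h1 h2
    have hsol : ∀ y' y, ∑ x, c n y' x * Q n x y' y = r y := by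
      intro y' y
      have : (B n y').mulVec (c n y') = r := by
        simp only [c]
        rw [Matrix.mulVec_mulVec, Matrix.mul_nonsing_inv _ (isUnit_iff_ne_zero.mpr (h2 y')),
          Matrix.one_mulVec]
      rw [← congrFun this y]
      simp only [B, Matrix.mulVec, dotProduct, Matrix.of_apply]
      exact Finset.sum_congr rfl fun x _ => by ring
    have hcs : ∀ y', ∑ x, c n y' x = 1 := by
      intro y'
      rw [← hr1]
      simp only [← hsol y']
      rw [Finset.sum_comm]
      simp only [← Finset.mul_sum, (hQ n).2, mul_one]
    refine ⟨⟨fun x y => mul_nonneg (h1 y x).le (hr0 y), ?_⟩, ?_⟩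
    · rw [Finset.sum_comm]
      simp only [← Finset.sum_mul, hcs, one_mul]
      exact hr1
    · intro y
      simp only [← Finset.sum_mul, hcs, one_mul]
      rw [Finset.sum_comm]
      have : ∀ y', ∑ x, c n y' x * r y' * Q n x y' y = r y' * r y := by
        intro y'
        rw [← hsol y' y, Finset.mul_sum]
        exact Finset.sum_congr rfl fun x _ => by ring
      simp only [this]
      rw [← Finset.sum_mul, hr1, one_mul]

/-- For a memoryless surjective channel `W` with `|𝒳| = |𝒴|`
(both alphabets the same finite set `α`, surjectivity reducing to positivity of the
capacity-achieving input distribution and invertibility of `W`), the maximizers of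
the optimization problem defining `C*_f(Q)` converge uniformly to the product
distribution `P_X^W ⊗ P_Y^W` as `δ → 0`. -/
theorem maximizers_converge_uniformly
    {α : Type*} [Fintype α] [DecidableEq α] (hα : 2 ≤ Fintype.card α)
    (W : α → α → ℝ) (hW0 : ∀ x y, 0 ≤ W x y) (hW1 : ∀ x, ∑ y : α, W x y = 1)
    (pX : α → ℝ) (hpX : IsPmf pX)
    (hpXopt : ∀ p : α → ℝ, IsPmf p → mlMI W p ≤ mlMI W pX)
    (hpos : ∀ x, 0 < pX x)
    (hinv : IsUnit ((Matrix.of fun y x => W x y) : Matrix α α ℝ)) :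
    ∀ ε > (0 : ℝ), ∃ δ > (0 : ℝ), ∀ Q : α → α → α → ℝ, IsPOST Q →
      (∀ x y' y, |Q x y' y - W x y| ≤ δ) →
      ∀ P : α → α → ℝ, IsFbMaximizer Q P →
        ∀ x y : α, |P x y - pX x * ∑ x' : α, pX x' * W x' y| ≤ ε := by
  intro ε hε
  by_contra! hcon
  have hd : ∀ n : ℕ, (0 : ℝ) < 1 / ((n : ℝ) + 1) := fun n => by positivity
  choose Q hQ hQd P hP x y hxy using fun n : ℕ => hcon (1 / ((n : ℝ) + 1)) (hd n)
  have hQlim : Tendsto Q atTop (𝓝 (fun x _ y => W x y)) := by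
    refine tendsto_pi_nhds.mpr fun a => tendsto_pi_nhds.mpr fun b => tendsto_pi_nhds.mpr fun c => ?_
    rw [tendsto_iff_dist_tendsto_zero]
    refine squeeze_zero (fun _ => dist_nonneg) (fun n => ?_)
      (tendsto_one_div_add_atTop_nhds_zero_nat (𝕜 := ℝ))
    rw [Real.dist_eq]
    exact hQd n a b c
  have hmem : ∀ n, P n ∈ Set.Icc (fun _ _ => 0 : α → α → ℝ) (fun _ _ => 1) := by
    intro n
    obtain ⟨h0, h1⟩ := (hP n).1
    refine ⟨fun a b => h0 a b, fun a b => ?_⟩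
    change P n a b ≤ 1
    rw [← h1]
    calc P n a b ≤ ∑ b, P n a b :=
          Finset.single_le_sum (fun b _ => h0 a b) (Finset.mem_univ b)
      _ ≤ _ := Finset.single_le_sum (f := fun a => ∑ b, P n a b)
          (fun a _ => Finset.sum_nonneg fun b _ => h0 a b) (Finset.mem_univ a)
  obtain ⟨L, -, φ, hφ, hL⟩ := (isCompact_Icc (a := (fun _ _ => 0 : α → α → ℝ))
    (b := fun _ _ => 1)).tendsto_subseq hmem
  have hLe : ∀ a b, Tendsto (fun n => P (φ n) a b) atTop (𝓝 (L a b)) := fun a b =>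
    (tendsto_pi_nhds.mp ((tendsto_pi_nhds.mp hL) a)) b
  have hQφ : Tendsto (fun n => Q (φ n)) atTop (𝓝 (fun x _ y => W x y)) :=
    hQlim.comp hφ.tendsto_atTop
  have hQe : ∀ a b c, Tendsto (fun n => Q (φ n) a b c) atTop (𝓝 (W a c)) := fun a b c =>
    (tendsto_pi_nhds.mp ((tendsto_pi_nhds.mp ((tendsto_pi_nhds.mp hQφ) a)) b)) c
  have hLpmf : IsJointPmf L := by
    refine ⟨fun a b => ge_of_tendsto' (hLe a b) fun n => (hP _).1.1 a b, ?_⟩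
    have h : Tendsto (fun n => ∑ a, ∑ b, P (φ n) a b) atTop (𝓝 (∑ a, ∑ b, L a b)) :=
      tendsto_finsetSum _ fun a _ => tendsto_finsetSum _ fun b _ => hLe a b
    simp only [(hP _).1.2] at h
    exact tendsto_nhds_unique h tendsto_const_nhds
  have hLst : StationaryFor (fun x _ y => W x y) L := by
    intro c
    have h : Tendsto (fun n => ∑ a, ∑ b, P (φ n) a b * Q (φ n) a b c) atTop
        (𝓝 (∑ a, ∑ b, L a b * W a c)) :=
      tendsto_finsetSum _ fun a _ => tendsto_finsetSum _ fun b _ => (hLe a b).mul (hQe a b c)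
    simp only [(hP _).2.1 c] at h
    exact tendsto_nhds_unique h (tendsto_finsetSum _ fun a _ => hLe a c)
  obtain ⟨R, hR, hRev⟩ := feasible_seq W hW0 hW1 hinv pX hpX hpos (fun n => Q (φ n))
    (fun n => hQ _) hQφ
  have hge : mlMI W pX ≤ entF (fun x _ y => W x y) L := by
    rw [← entF_prod W hW0 hW1 pX hpX]
    have t1 := entF_tendsto hQφ hR
    have t2 := entF_tendsto hQφ hL
    refine le_of_tendsto_of_tendsto t1 t2 ?_
    filter_upwards [hRev] with n hn
    simp only [Function.comp]
    rw [← fbMI_eq _ _ (hQ _) hn.1.1, ← fbMI_eq _ _ (hQ _) (hP _).1.1]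
    exact (hP _).2.2 _ hn.1 hn.2
  have hLeq := limit_unique W hW0 hW1 hinv pX hpX hpXopt L hLpmf hLst hge
  have hev : ∀ᶠ n in atTop, ∀ a b, |P (φ n) a b - pX a * ∑ x' : α, pX x' * W x' b| < ε := by
    rw [eventually_all]; intro a
    rw [eventually_all]; intro b
    rw [← hLeq a b]
    have := (Metric.tendsto_nhds.mp (hLe a b)) ε hε
    simpa only [Real.dist_eq] using this
  obtain ⟨n, hn⟩ := hev.exists
  exact absurd (hn (x (φ n)) (y (φ n))) (not_lt.mpr (hxy (φ n)).le)
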